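/- arXiv:1710.10643 — 3 statements merged into one kernel-verified Lean document; each statement's English description precedes it below -/
import Mathlib

section
/- (Lemma 2) Let a ∈ ℂ and m ≥ 1. A smooth function y : ℝ → ℂ satisfies D_{(X−a)^m}[y] = 0 if and only if there exists a polynomial C with complex coefficients of degree at most m − 1 such that y(x) = C(x) · e^{ax} for all x ∈ ℝ. -/
open Polynomial

/-- The constant-coefficient linear differential operator associated to a
polynomial `P = ∑ cᵢ Xⁱ` over `ℂ`: `D_P[y] = ∑ cᵢ · y⁽ⁱ⁾`. -/
noncomputable def diffOp (P : Polynomial ℂ) (y : ℝ → ℂ) : ℝ → ℂ :=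
  fun x => ∑ i ∈ Finset.range (P.natDegree + 1), P.coeff i * iteratedDeriv i y x

theorem Polynomial.exists_derivative_eq_of_degree_lt {K : Type*} [Field K] [CharZero K]
    {p : K[X]} {m : ℕ} (hp : p.degree < m) :
    ∃ q : K[X], derivative q = p ∧ q.degree < (m + 1 : ℕ) := by
  refine ⟨∑ i ∈ Finset.range m, monomial (i + 1) (p.coeff i / (i + 1)), ?_, ?_⟩
  · ext n
    simp only [derivative_sum, derivative_monomial, finsetSum_coeff, coeff_monomial]
    have hn : (n : K) + 1 ≠ 0 := Nat.cast_add_one_ne_zero n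
    by_cases hnm : n < m
    · simp [hnm, hn]
    · have : p.coeff n = 0 :=
        coeff_eq_zero_of_degree_lt (hp.trans_le (by exact_mod_cast not_lt.mp hnm))
      simp [this]
  · rw [← mem_degreeLT]
    refine Submodule.sum_mem _ fun i hi => mem_degreeLT.mpr ?_
    refine (degree_monomial_le _ _).trans_lt ?_
    have := Finset.mem_range.mp hi
    exact_mod_cast Nat.succ_lt_succ this

theorem Polynomial.hasDerivAt_eval_ofReal (p : ℂ[X]) (x : ℝ) :
    HasDerivAt (fun t : ℝ => p.eval (t : ℂ)) (p.derivative.eval (x : ℂ)) x :=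
  (p.hasDerivAt (x : ℂ)).comp_ofReal

theorem Polynomial.iteratedDeriv_eval_ofReal (p : ℂ[X]) (n : ℕ) :
    iteratedDeriv n (fun t : ℝ => p.eval (t : ℂ)) =
      fun t : ℝ => (derivative^[n] p).eval (t : ℂ) := by
  induction n with
  | zero => simp
  | succ n ih =>
    ext x
    rw [iteratedDeriv_succ, ih, Function.iterate_succ_apply']
    exact (hasDerivAt_eval_ofReal _ x).deriv

theorem iteratedDeriv_eq_zero_iff_exists_polynomial (m : ℕ) {z : ℝ → ℂ}
    (hz : ContDiff ℝ (⊤ : ℕ∞) z) :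
    iteratedDeriv m z = 0 ↔ ∃ p : ℂ[X], p.degree < m ∧ ∀ x : ℝ, z x = p.eval (x : ℂ) := by
  constructor
  · induction m generalizing z with
    | zero =>
      intro h
      exact ⟨0, by simp, fun x => by simpa using congrFun h x⟩
    | succ m ih =>
      intro h
      rw [iteratedDeriv_succ'] at h
      obtain ⟨p, hp, hpz⟩ := ih (contDiff_infty_iff_deriv.mp hz).2 h
      obtain ⟨q, rfl, hq⟩ := exists_derivative_eq_of_degree_lt hp
      have hd (x : ℝ) : HasDerivAt (fun t : ℝ => z t - q.eval (t : ℂ)) 0 x := by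
        have hzx := ((contDiff_infty_iff_deriv.mp hz).1 x).hasDerivAt
        rw [hpz] at hzx
        simpa using! hzx.sub (q.hasDerivAt_eval_ofReal x)
      refine ⟨q + C (z 0 - q.eval 0), ?_, fun x => ?_⟩
      · refine (degree_add_le _ _).trans_lt (max_lt hq (degree_C_le.trans_lt ?_))
        exact_mod_cast Nat.succ_pos m
      · have := is_const_of_deriv_eq_zero (fun t => (hd t).differentiableAt)
          (fun t => (hd t).deriv) x 0
        simp only [Complex.ofReal_zero] at this
        rw [eval_add, eval_C, ← this]
        ring
  · rintro ⟨p, hp, hpz⟩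
    rw [funext hpz, iteratedDeriv_eval_ofReal, iterate_derivative_eq_zero_of_degree_lt hp]
    ext
    simp

theorem iteratedDeriv_cexp_const_mul_ofReal (n : ℕ) (c : ℂ) :
    iteratedDeriv n (fun t : ℝ => Complex.exp (c * t)) =
      fun t : ℝ => c ^ n * Complex.exp (c * t) := by
  induction n with
  | zero => simp
  | succ n ih =>
    ext x
    rw [iteratedDeriv_succ, ih]
    have h := (((hasDerivAt_id (x : ℂ)).const_mul c).cexp.const_mul (c ^ n)).comp_ofReal
    simp only [id, mul_one] at h
    rw [h.deriv]
    ring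

theorem contDiff_cexp_const_mul_ofReal (c : ℂ) (n : WithTop ℕ∞) :
    ContDiff ℝ n (fun t : ℝ => Complex.exp (c * t)) :=
  (contDiff_const.mul Complex.ofRealCLM.contDiff).cexp

theorem diffOp_X_sub_C_pow (a : ℂ) (m : ℕ) {y : ℝ → ℂ} (hy : ContDiff ℝ (⊤ : ℕ∞) y) (x : ℝ) :
    iteratedDeriv m (y * fun t : ℝ => Complex.exp (-a * t)) x =
      diffOp ((X - C a) ^ m) y x * Complex.exp (-a * x) := by
  rw [iteratedDeriv_mul (hy.of_le (by exact_mod_cast le_top)).contDiffAt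
    (contDiff_cexp_const_mul_ofReal _ _).contDiffAt, diffOp, natDegree_pow, natDegree_X_sub_C,
    mul_one, Finset.sum_mul]
  refine Finset.sum_congr rfl fun i _ => ?_
  rw [iteratedDeriv_cexp_const_mul_ofReal, sub_eq_add_neg, ← C_neg, coeff_X_add_C_pow]
  ring

theorem diffOp_pow_eq_zero_iff (a : ℂ) (m : ℕ) (hm : 1 ≤ m)
    (y : ℝ → ℂ) (hy : ContDiff ℝ (⊤ : ℕ∞) y) :
    diffOp ((X - C a) ^ m) y = 0 ↔
      ∃ p : Polynomial ℂ, p.degree ≤ (m - 1 : ℕ) ∧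
        ∀ x : ℝ, y x = p.eval (x : ℂ) * Complex.exp (a * x) := by
  have hz : ContDiff ℝ (⊤ : ℕ∞) (y * fun t : ℝ => Complex.exp (-a * t)) :=
    hy.mul (contDiff_cexp_const_mul_ofReal _ _)
  have hdeg (p : ℂ[X]) : p.degree ≤ (m - 1 : ℕ) ↔ p.degree < m := by
    rw [degree_le_iff_coeff_zero, degree_lt_iff_coeff_zero]
    exact forall_congr' fun k => imp_congr_left (by rw [Nat.cast_lt]; lia)
  have hD : diffOp ((X - C a) ^ m) y = 0 ↔
      iteratedDeriv m (y * fun t : ℝ => Complex.exp (-a * t)) = 0 := by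
    simp only [funext_iff, diffOp_X_sub_C_pow a m hy, Pi.zero_apply, mul_eq_zero,
      Complex.exp_ne_zero, or_false]
  rw [hD, iteratedDeriv_eq_zero_iff_exists_polynomial m hz]
  refine exists_congr fun p => and_congr (hdeg p).symm (forall_congr' fun x => ?_)
  rw [Pi.mul_apply, neg_mul, Complex.exp_neg, ← div_eq_mul_inv,
    div_eq_iff (Complex.exp_ne_zero _)]
end

section
/- (Main Theorem) Let P = ∏_{i=1}^k (X − r_i)^{m_i} with pairwise distinct r_1, …, r_k ∈ ℂ and m_i ≥ 1. A smooth function y : ℝ → ℂ satisfies D_P[y] = 0 if and only if there exist polynomials p_1, …, p_k with complex coefficients, with deg p_i ≤ m_i − 1 for each i, such that y(x) = ∑_{i=1}^k p_i(x) · e^{r_i x} for all x ∈ ℝ. -/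
open Polynomial

/-- For pairwise coprime polynomials `q i`, the kernel of `(∏ i ∈ s, q i)(f)` is the span of the
kernels of the `q i (f)`. -/
theorem iSup_ker_aeval_eq_ker_aeval_prod {K M ι : Type*} [CommRing K] [AddCommGroup M] [Module K M]
    (f : M →ₗ[K] M) (q : ι → K[X]) (s : Finset ι)
    (hq : Pairwise (Function.onFun IsCoprime q)) :
    ⨆ i ∈ s, LinearMap.ker (aeval f (q i)) = LinearMap.ker (aeval f (∏ i ∈ s, q i)) := by
  classical
  induction s using Finset.induction_on with
  | empty => simp [Module.End.one_eq_id]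
  | insert a s ha ih =>
    rw [Finset.iSup_insert, ih, Finset.prod_insert ha]
    exact sup_ker_aeval_eq_ker_aeval_mul_of_coprime f
      (IsCoprime.prod_right fun i hi => hq fun h => ha (h ▸ hi))

/-- Polynomials over a field of characteristic zero have antiderivatives. -/
theorem Polynomial.exists_derivative_eq {K : Type*} [Field K] [CharZero K] (p : K[X]) {n : ℕ}
    (hp : p.degree < n) : ∃ q : K[X], q.degree < (n + 1 : ℕ) ∧ derivative q = p := by
  refine ⟨∑ i ∈ Finset.range n, monomial (i + 1) (p.coeff i / (i + 1)), ?_, ?_⟩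
  · rw [← mem_degreeLT]
    refine Submodule.sum_mem _ fun i hi => mem_degreeLT.2 ?_
    refine (degree_monomial_le _ _).trans_lt ?_
    exact_mod_cast Nat.succ_lt_succ (Finset.mem_range.1 hi)
  · rw [derivative_sum]
    ext j
    have h (i : ℕ) : p.coeff i / ((i : K) + 1) * ((i : K) + 1) = p.coeff i :=
      div_mul_cancel₀ _ (by exact_mod_cast Nat.succ_ne_zero i)
    simp only [derivative_monomial, Nat.cast_add, Nat.cast_one, Nat.add_sub_cancel, h,
      finsetSum_coeff, coeff_monomial, Finset.sum_ite_eq', Finset.mem_range]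
    split_ifs with hj
    · rfl
    · exact (coeff_eq_zero_of_degree_lt (hp.trans_le (by exact_mod_cast not_lt.1 hj))).symm

/-- The space of smooth functions `ℝ → ℂ`. -/
def smoothFunctions : Submodule ℂ (ℝ → ℂ) where
  carrier := {f | ContDiff ℝ (⊤ : ℕ∞) f}
  add_mem' hf hg := ContDiff.add (Set.mem_ofPred.1 hf) (Set.mem_ofPred.1 hg)
  zero_mem' := Set.mem_ofPred.2 contDiff_const
  smul_mem' _ _ hf := Set.mem_ofPred.2 (contDiff_const.smul (Set.mem_ofPred.1 hf))

theorem contDiff_coe (f : smoothFunctions) : ContDiff ℝ (⊤ : ℕ∞) (f : ℝ → ℂ) :=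
  f.2

theorem differentiable_coe (f : smoothFunctions) : Differentiable ℝ (f : ℝ → ℂ) :=
  (contDiff_coe f).differentiable (by simp)

/-- Differentiation as an endomorphism of the space of smooth functions. -/
noncomputable def smoothDeriv : smoothFunctions →ₗ[ℂ] smoothFunctions where
  toFun f := ⟨deriv f, (contDiff_infty_iff_deriv.1 (contDiff_coe f)).2⟩
  map_add' f g := Subtype.ext <| funext fun x =>
    deriv_add (differentiable_coe f x) (differentiable_coe g x)
  map_smul' c f := Subtype.ext <| funext fun x =>
    deriv_const_smul c (differentiable_coe f x)

theorem smoothDeriv_pow_apply (n : ℕ) (f : smoothFunctions) :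
    ((smoothDeriv ^ n) f : ℝ → ℂ) = iteratedDeriv n f := by
  induction n with
  | zero => simp
  | succ n ih =>
    rw [pow_succ', iteratedDeriv_succ, ← ih]
    rfl

theorem aeval_smoothDeriv_apply (P : ℂ[X]) (f : smoothFunctions) :
    (aeval smoothDeriv P f : ℝ → ℂ) = diffOp P f := by
  ext x
  rw [aeval_eq_sum_range]
  simp [diffOp, smoothDeriv_pow_apply, Finset.sum_apply]

theorem Polynomial.hasDerivAt_mul_cexp (p : ℂ[X]) (r : ℂ) (x : ℝ) :
    HasDerivAt (fun x : ℝ => p.eval (x : ℂ) * Complex.exp (r * x))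
      ((derivative p).eval (x : ℂ) * Complex.exp (r * x) +
        r * (p.eval (x : ℂ) * Complex.exp (r * x))) x := by
  have h : HasDerivAt (fun z : ℂ => p.eval z * Complex.exp (r * z)) _ (x : ℂ) :=
    (p.hasDerivAt (x : ℂ)).mul ((hasDerivAt_id (x : ℂ)).const_mul r).cexp
  convert h.comp_ofReal using 1
  simp only [id]
  ring

/-- The exponential polynomial `x ↦ p(x) e^{r x}` as a smooth function. -/
noncomputable def expPoly (r : ℂ) (p : ℂ[X]) : smoothFunctions :=
  ⟨fun x => p.eval (x : ℂ) * Complex.exp (r * x), by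
    have h := Complex.ofRealCLM.contDiff (n := (⊤ : ℕ∞))
    exact ((p.contDiff_aeval (𝕜 := ℂ) _).restrict_scalars ℝ |>.comp h).mul
      (Complex.contDiff_exp.comp (contDiff_const.mul h))⟩

theorem aeval_smoothDeriv_X_sub_C_apply (r : ℂ) (f : smoothFunctions) (x : ℝ) :
    (aeval smoothDeriv (X - C r) f : ℝ → ℂ) x = deriv f x - r * (f : ℝ → ℂ) x := by
  simp [Algebra.algebraMap_eq_smul_one, smoothDeriv]

theorem aeval_smoothDeriv_X_sub_C_expPoly (r : ℂ) (p : ℂ[X]) :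
    aeval smoothDeriv (X - C r) (expPoly r p) = expPoly r (derivative p) := by
  ext x
  rw [aeval_smoothDeriv_X_sub_C_apply]
  simp only [expPoly]
  rw [(p.hasDerivAt_mul_cexp r x).deriv]
  ring

theorem mem_ker_aeval_smoothDeriv_X_sub_C (r : ℂ) (f : smoothFunctions)
    (hf : aeval smoothDeriv (X - C r) f = 0) : ∃ c : ℂ, f = expPoly r (C c) := by
  have hd (x : ℝ) : HasDerivAt (fun x : ℝ => (f : ℝ → ℂ) x * Complex.exp (-r * x)) 0 x := by
    have he : HasDerivAt (fun x : ℝ => Complex.exp (-r * x)) (-r * Complex.exp (-r * x)) x := by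
      simpa using (C (1 : ℂ)).hasDerivAt_mul_cexp (-r) x
    have hx := aeval_smoothDeriv_X_sub_C_apply r f x
    rw [hf] at hx
    have hx' : deriv (f : ℝ → ℂ) x = r * (f : ℝ → ℂ) x := sub_eq_zero.1 hx.symm
    refine ((differentiable_coe f x).hasDerivAt.mul he).congr_deriv ?_
    rw [hx']
    ring
  have hc := is_const_of_deriv_eq_zero (fun x => (hd x).differentiableAt) fun x => (hd x).deriv
  refine ⟨(f : ℝ → ℂ) 0, Subtype.ext <| funext fun x => ?_⟩
  have h0 := hc x 0
  simp only [Complex.ofReal_zero, mul_zero, Complex.exp_zero, mul_one] at h0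
  simp only [expPoly, eval_C]
  rw [← h0, mul_assoc, ← Complex.exp_add]
  simp

theorem expPoly_add (r : ℂ) (p q : ℂ[X]) : expPoly r (p + q) = expPoly r p + expPoly r q :=
  Subtype.ext <| funext fun x => by simp [expPoly, add_mul]

/-- The kernel of `(D - r)^m` consists of the functions `p(x) e^{r x}` with `deg p < m`. -/
theorem aeval_smoothDeriv_X_sub_C_pow_eq_zero_iff (r : ℂ) (m : ℕ) (f : smoothFunctions) :
    aeval smoothDeriv ((X - C r) ^ m) f = 0 ↔ ∃ p : ℂ[X], p.degree < m ∧ f = expPoly r p := by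
  induction m generalizing f with
  | zero =>
    have h0 : expPoly r 0 = 0 := Subtype.ext <| funext fun x => by simp [expPoly]
    simp [Nat.WithBot.lt_zero_iff, h0]
  | succ m ih =>
    rw [pow_succ, map_mul, Module.End.mul_apply, ih]
    constructor
    · rintro ⟨p, hp, hf⟩
      obtain ⟨q, hq, rfl⟩ := p.exists_derivative_eq hp
      obtain ⟨c, hc⟩ := mem_ker_aeval_smoothDeriv_X_sub_C r (f - expPoly r q) (by
        rw [map_sub, hf, aeval_smoothDeriv_X_sub_C_expPoly, sub_self])
      refine ⟨C c + q, (degree_add_le _ _).trans_lt (max_lt ?_ hq), ?_⟩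
      · exact degree_C_le.trans_lt (by exact_mod_cast m.succ_pos)
      · rw [expPoly_add, ← hc, sub_add_cancel]
    · rintro ⟨p, hp, rfl⟩
      refine ⟨derivative p, ?_, aeval_smoothDeriv_X_sub_C_expPoly r p⟩
      by_cases h : p = 0
      · simp [h]
      · exact (degree_derivative_lt h).trans_le (by
          rw [degree_eq_natDegree h] at hp ⊢
          exact_mod_cast Nat.lt_succ_iff.1 (by exact_mod_cast hp))

theorem diffOp_prod_eq_zero_iff (k : ℕ) (r : Fin k → ℂ) (m : Fin k → ℕ)
    (hr : Function.Injective r) (hm : ∀ i, 1 ≤ m i)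
    (y : ℝ → ℂ) (hy : ContDiff ℝ (⊤ : ℕ∞) y) :
    diffOp (∏ j, (X - C (r j)) ^ (m j)) y = 0 ↔
      ∃ p : Fin k → Polynomial ℂ, (∀ i, (p i).degree ≤ (m i - 1 : ℕ)) ∧
        ∀ x : ℝ, y x = ∑ i, (p i).eval (x : ℂ) * Complex.exp (r i * x) := by
  have hdeg (i : Fin k) (p : ℂ[X]) : p.degree ≤ (m i - 1 : ℕ) ↔ p.degree < m i := by
    by_cases h : p = 0
    · simp [h]
    · have := hm i
      rw [degree_eq_natDegree h, Nat.cast_le, Nat.cast_lt]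
      lia
  have hcop : Pairwise (Function.onFun IsCoprime fun j => (X - C (r j)) ^ (m j)) :=
    fun i j hij => (pairwise_coprime_X_sub_C hr hij).pow
  let f : smoothFunctions := ⟨y, hy⟩
  have hker : diffOp (∏ j, (X - C (r j)) ^ (m j)) y = 0 ↔
      aeval smoothDeriv (∏ j, (X - C (r j)) ^ (m j)) f = 0 := by
    rw [← aeval_smoothDeriv_apply _ f, ZeroMemClass.coe_eq_zero]
  have hsum (p : Fin k → ℂ[X]) : (∑ i, expPoly (r i) (p i) = f) ↔
      ∀ x : ℝ, y x = ∑ i, (p i).eval (x : ℂ) * Complex.exp (r i * x) := by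
    rw [Subtype.ext_iff, funext_iff]
    simp [expPoly, f, eq_comm, Finset.sum_apply]
  simp only [hdeg, ← hsum]
  rw [hker, ← LinearMap.mem_ker, ← iSup_ker_aeval_eq_ker_aeval_prod _ _ _ hcop,
    Submodule.mem_iSup_finset_iff_exists_sum]
  constructor
  · rintro ⟨μ, hμ⟩
    choose p hp hμp using fun i =>
      (aeval_smoothDeriv_X_sub_C_pow_eq_zero_iff (r i) (m i) (μ i)).1 (μ i).2
    exact ⟨p, hp, by simpa only [hμp] using hμ⟩
  · rintro ⟨p, hp, hf⟩
    exact ⟨fun i => ⟨expPoly (r i) (p i),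
      (aeval_smoothDeriv_X_sub_C_pow_eq_zero_iff (r i) (m i) _).2 ⟨p i, hp i, rfl⟩⟩, hf⟩
end

section
/- (Resonant particular solution) Let b ∈ ℂ, m ≥ 1, and let P = (X − b)^m · R where R is a polynomial with complex coefficients satisfying R(b) ≠ 0. Let Q be a polynomial with complex coefficients of degree j. Then there exists a polynomial S with complex coefficients of degree j such that the function y(x) = x^m · S(x) · e^{bx} satisfies D_P[y](x) = e^{bx} Q(x) for all x ∈ ℝ. -/
open Polynomial

/-- The derivation of `ℂ[X]`, shifted by `b`, intertwines differentiation of `F(t) e^{bt}`. -/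
theorem iteratedDeriv_eval_mul_exp (b : ℂ) (F : ℂ[X]) (i : ℕ) :
    iteratedDeriv i (fun t : ℝ => F.eval (t : ℂ) * Complex.exp (b * t)) =
      fun t : ℝ => (((aeval (derivative : Module.End ℂ ℂ[X]) (X + C b)) ^ i) F).eval (t : ℂ) *
        Complex.exp (b * t) := by
  induction i with
  | zero => simp
  | succ i ih =>
    rw [iteratedDeriv_succ, ih, pow_succ']
    funext t
    rw [Module.End.mul_apply]
    generalize ((aeval (derivative : Module.End ℂ ℂ[X]) (X + C b)) ^ i) F = G
    have hexp : HasDerivAt (fun z : ℂ => Complex.exp (b * z))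
        (Complex.exp (b * t) * (b * 1)) (t : ℂ) :=
      ((hasDerivAt_id (t : ℂ)).const_mul b).cexp
    have h := ((G.hasDerivAt (t : ℂ)).mul hexp).comp_ofReal
    refine Eq.trans h.deriv ?_
    simp only [map_add, aeval_X, aeval_C, LinearMap.add_apply,
      Module.algebraMap_end_apply, eval_add, eval_smul, smul_eq_mul]
    ring

theorem diffOp_eval_mul_exp (b : ℂ) (P F : ℂ[X]) (x : ℝ) :
    diffOp P (fun t : ℝ => F.eval (t : ℂ) * Complex.exp (b * t)) x =
      Complex.exp (b * x) *
        (aeval (derivative : Module.End ℂ ℂ[X]) (taylor b P) F).eval (x : ℂ) := by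
  rw [taylor_apply, aeval_comp, aeval_eq_sum_range]
  simp only [diffOp, iteratedDeriv_eval_mul_exp, LinearMap.sum_apply, LinearMap.smul_apply,
    eval_finsetSum, eval_smul, smul_eq_mul, Finset.mul_sum]
  exact Finset.sum_congr rfl fun i _ => by ring

theorem degree_aeval_derivative_le (V F : ℂ[X]) :
    (aeval (derivative : Module.End ℂ ℂ[X]) V F).degree ≤ F.degree := by
  induction V using Polynomial.induction_on' with
  | add p q hp hq =>
    rw [map_add, LinearMap.add_apply]
    exact (degree_add_le _ _).trans (max_le hp hq)
  | monomial n a =>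
    rw [aeval_monomial, Module.End.mul_apply, Module.algebraMap_end_apply]
    refine (degree_smul_le _ _).trans ?_
    induction n with
    | zero => simp
    | succ n ih =>
      rw [pow_succ', Module.End.mul_apply]
      exact degree_derivative_le.trans ih

theorem degree_aeval_derivative_eq {V : ℂ[X]} (hV : V.coeff 0 ≠ 0) (F : ℂ[X]) :
    (aeval (derivative : Module.End ℂ ℂ[X]) V F).degree = F.degree := by
  rcases eq_or_ne F 0 with rfl | hF
  · simp
  have hsplit : aeval (derivative : Module.End ℂ ℂ[X]) V F =
      aeval (derivative : Module.End ℂ ℂ[X]) V.divX (derivative F) + V.coeff 0 • F := by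
    conv_lhs => rw [← divX_mul_X_add V]
    simp only [map_add, map_mul, aeval_X, aeval_C, LinearMap.add_apply, Module.End.mul_apply,
      Module.algebraMap_end_apply]
  have hdeg : (V.coeff 0 • F).degree = F.degree := by
    rw [smul_eq_C_mul, degree_C_mul hV]
  rw [hsplit, degree_add_eq_right_of_degree_lt, hdeg]
  rw [hdeg]
  exact (degree_aeval_derivative_le _ _).trans_lt (degree_derivative_lt hF)

theorem degree_derivative_pow {m : ℕ} {G S : ℂ[X]} (h : G.degree = S.degree + m) :
    (((derivative : Module.End ℂ ℂ[X]) ^ m) G).degree = S.degree := by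
  induction m generalizing G with
  | zero => simpa using h
  | succ m ih =>
    rw [pow_succ, Module.End.mul_apply]
    refine ih ?_
    rcases eq_or_ne S 0 with rfl | hS
    · have hG : G = 0 := by simpa using h
      simp [hG]
    · rw [degree_eq_natDegree hS] at h ⊢
      have hn : G.natDegree = S.natDegree + (m + 1) :=
        natDegree_eq_of_degree_eq_some (by rw [h]; push_cast; rfl)
      rw [degree_derivative (p := G) (by omega), hn]
      push_cast [Nat.add_sub_cancel, ← add_assoc]
      rfl

/-- A degree-preserving endomorphism of `K[X]` is surjective. -/
theorem exists_eq_of_degree_preserving {K : Type*} [Field K] (M : K[X] →ₗ[K] K[X])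
    (hM : ∀ S, (M S).degree = S.degree) (Q : K[X]) : ∃ S, M S = Q := by
  let W := degreeLT K (Q.natDegree + 1)
  have hW : ∀ S ∈ W, M S ∈ W := fun S hS => by
    rw [mem_degreeLT] at hS ⊢
    rwa [hM]
  have : FiniteDimensional K W :=
    Module.Finite.equiv (degreeLTEquiv K (Q.natDegree + 1)).symm
  have hinj : Function.Injective (M.restrict hW) := by
    rw [injective_iff_map_eq_zero]
    intro S hS
    have h : M S = 0 := congrArg Subtype.val hS
    exact Subtype.ext (degree_eq_bot.1 (by rw [← hM, h, degree_zero]))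
  have hQ : Q ∈ W :=
    mem_degreeLT.2 (degree_le_natDegree.trans_lt (by exact_mod_cast Nat.lt_succ_self _))
  obtain ⟨S, hS⟩ := LinearMap.injective_iff_surjective.1 hinj ⟨Q, hQ⟩
  exact ⟨S, congrArg Subtype.val hS⟩

theorem exists_resonant_particular_solution (b : ℂ) (m : ℕ) (hm : 1 ≤ m)
    (R : Polynomial ℂ) (hR : R.eval b ≠ 0) (P : Polynomial ℂ)
    (hP : P = (X - C b) ^ m * R)
    (j : ℕ) (Q : Polynomial ℂ) (hQ : Q.degree = (j : ℕ)) :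
    ∃ S : Polynomial ℂ, S.degree = (j : ℕ) ∧
      ∀ x : ℝ, diffOp P
          (fun t : ℝ => (t : ℂ) ^ m * S.eval (t : ℂ) * Complex.exp (b * t)) x =
        Complex.exp (b * x) * Q.eval (x : ℂ) := by
  let M : ℂ[X] →ₗ[ℂ] ℂ[X] :=
    aeval (derivative : Module.End ℂ ℂ[X]) (taylor b P) ∘ₗ LinearMap.mulLeft ℂ (X ^ m)
  have htaylor : taylor b P = X ^ m * taylor b R := by
    simp [hP, taylor_apply]
  have hM : ∀ S, (M S).degree = S.degree := fun S => by
    have hMS : M S = ((derivative : Module.End ℂ ℂ[X]) ^ m)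
        (aeval (derivative : Module.End ℂ ℂ[X]) (taylor b R) (X ^ m * S)) := by
      simp only [M, htaylor, map_mul, map_pow, aeval_X, LinearMap.comp_apply,
        LinearMap.mulLeft_apply, Module.End.mul_apply]
    rw [hMS]
    refine degree_derivative_pow ?_
    rw [degree_aeval_derivative_eq (by rwa [taylor_coeff_zero]), degree_mul, degree_X_pow,
      add_comm]
  obtain ⟨S, hS⟩ := exists_eq_of_degree_preserving M hM Q
  refine ⟨S, by rw [← hM, hS, hQ], fun x => ?_⟩
  have h := diffOp_eval_mul_exp b P (X ^ m * S) x
  simp only [eval_mul, eval_pow, eval_X] at h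
  rw [h, ← hS]
  rfl
end
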